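/- arXiv:0707.3862 — 5 statements merged into one kernel-verified Lean document; each statement's English description precedes it below -/
import Mathlib

section
/- Let p and m be positive integers, and let A(x) = Σ_{k=0}^{p} a_k x^{p−k} be a real polynomial of degree p (a_0 ≠ 0) with no real zeros. Then there exist a real polynomial Z(x) = Σ_{k=0}^{r} z_k x^{r−k} of degree r = p(m−1) and real numbers e_0, e_1, …, e_p such that A(x)·Z(x) = Σ_{l=0}^{p} e_l [P_m(x)]^{p−l} [Q_m(x)]^{l} as polynomials. -/
open Polynomial

/-- The polynomial `P_m(x) = Σ_{j=0}^{⌊m/2⌋} (−1)^j C(m,2j) x^{m−2j}` in `ℝ[x]`. -/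
noncomputable def Ppoly (m : ℕ) : Polynomial ℝ :=
  ∑ j ∈ Finset.range (m / 2 + 1),
    Polynomial.C ((-1 : ℝ) ^ j * (m.choose (2 * j))) * Polynomial.X ^ (m - 2 * j)

/-- The polynomial `Q_m(x) = Σ_{j=0}^{⌊(m−1)/2⌋} (−1)^j C(m,2j+1) x^{m−2j−1}` in `ℝ[x]`. -/
noncomputable def Qpoly (m : ℕ) : Polynomial ℝ :=
  ∑ j ∈ Finset.range ((m - 1) / 2 + 1),
    Polynomial.C ((-1 : ℝ) ^ j * (m.choose (2 * j + 1))) * Polynomial.X ^ (m - (2 * j + 1))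

theorem Finset.sum_range_succ_eq_even_add_odd {M : Type*} [AddCommMonoid M] {m : ℕ} (hm : 0 < m)
    (f : ℕ → M) :
    ∑ k ∈ Finset.range (m + 1), f k = ∑ j ∈ Finset.range (m / 2 + 1), f (2 * j) +
      ∑ j ∈ Finset.range ((m - 1) / 2 + 1), f (2 * j + 1) := by
  have key : ∀ n, ∑ k ∈ Finset.range (2 * n), f k =
      ∑ j ∈ Finset.range n, f (2 * j) + ∑ j ∈ Finset.range n, f (2 * j + 1) := by
    intro n
    induction n with
    | zero => simp
    | succ n ih =>
      rw [Nat.mul_succ, Finset.sum_range_succ, Finset.sum_range_succ, ih,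
        Finset.sum_range_succ, Finset.sum_range_succ]
      abel
  obtain ⟨n, rfl | rfl⟩ := Nat.even_or_odd' m
  · rw [Finset.sum_range_succ, key, show 2 * n / 2 + 1 = n + 1 by omega,
      show (2 * n - 1) / 2 + 1 = n by omega, Finset.sum_range_succ (fun j => f (2 * j))]
    abel
  · rw [show 2 * n + 1 + 1 = 2 * (n + 1) by ring, key, show (2 * n + 1) / 2 + 1 = n + 1 by omega,
      show (2 * n + 1 - 1) / 2 + 1 = n + 1 by omega]

theorem aeval_Ppoly_add_mul_aeval_Qpoly {R : Type*} [CommRing R] [Algebra ℝ R] {m : ℕ}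
    (hm : 0 < m) (z c : R) (hc : c ^ 2 = -1) :
    aeval z (Ppoly m) + c * aeval z (Qpoly m) = (c + z) ^ m := by
  rw [add_pow, Finset.sum_range_succ_eq_even_add_odd hm, Ppoly, Qpoly, map_sum, map_sum,
    Finset.mul_sum]
  congr 1 <;> refine Finset.sum_congr rfl fun j _ => ?_
  · simp only [map_mul, map_pow, aeval_X, map_neg, map_one, map_natCast, pow_mul, hc]
    ring
  · rw [pow_succ c, pow_mul c, hc]
    simp only [map_mul, map_pow, aeval_X, map_neg, map_one, map_natCast]
    ring

theorem monic_Ppoly (m : ℕ) : (Ppoly m).Monic ∧ (Ppoly m).natDegree = m := by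
  have hdeg : (∑ j ∈ Finset.range (m / 2), C ((-1 : ℝ) ^ (j + 1) * (m.choose (2 * (j + 1)))) *
      X ^ (m - 2 * (j + 1))).degree < (m : WithBot ℕ) := by
    refine (degree_sum_le _ _).trans_lt ((Finset.sup_lt_iff (WithBot.bot_lt_coe m)).2 ?_)
    intro j hj
    refine (degree_C_mul_X_pow_le _ _).trans_lt ?_
    have := Finset.mem_range.1 hj
    exact WithBot.coe_lt_coe.2 (by omega : m - 2 * (j + 1) < m)
  have hP : Ppoly m = X ^ m + ∑ j ∈ Finset.range (m / 2),
      C ((-1 : ℝ) ^ (j + 1) * (m.choose (2 * (j + 1)))) * X ^ (m - 2 * (j + 1)) := by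
    rw [Ppoly, Finset.sum_range_succ', add_comm]
    simp
  rw [hP]
  refine ⟨monic_X_pow_add hdeg, ?_⟩
  rw [natDegree_add_eq_left_of_degree_lt (by simpa using hdeg), natDegree_X_pow]

theorem natDegree_Qpoly_le (m : ℕ) : (Qpoly m).natDegree ≤ m - 1 :=
  natDegree_sum_le_of_forall_le _ _ fun _ _ =>
    (natDegree_C_mul_X_pow_le _ _).trans (by omega)

theorem aeval_Qpoly_ne_zero {m : ℕ} (hm : 0 < m) {z : ℂ} (hz : z.im ≠ 0) :
    aeval z (Qpoly m) ≠ 0 := by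
  intro h
  have h1 := aeval_Ppoly_add_mul_aeval_Qpoly hm z Complex.I (by simp)
  have h2 := aeval_Ppoly_add_mul_aeval_Qpoly hm z (-Complex.I) (by simp)
  rw [h, mul_zero, add_zero] at h1 h2
  have h3 : ‖Complex.I + z‖ = ‖-Complex.I + z‖ := by
    refine (pow_left_inj₀ (norm_nonneg _) (norm_nonneg _) hm.ne').1 ?_
    rw [← norm_pow, ← norm_pow, ← h1, ← h2]
  have h4 := congrArg (· ^ 2) h3
  simp only [Complex.sq_norm, Complex.normSq_apply, Complex.add_re, Complex.add_im, Complex.neg_re,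
    Complex.neg_im, Complex.I_re, Complex.I_im] at h4
  exact hz (by linarith)

theorem isCoprime_Qpoly {m : ℕ} (hm : 0 < m) {A : ℝ[X]} (hA : ∀ x : ℝ, A.eval x ≠ 0) :
    IsCoprime (Qpoly m) A := by
  rw [isCoprime_iff_aeval_ne_zero_of_isAlgClosed ℝ ℂ]
  intro z
  by_cases hz : z.im = 0
  · right
    obtain ⟨x, rfl⟩ : ∃ x : ℝ, algebraMap ℝ ℂ x = z := ⟨z.re, Complex.ext rfl (by simp [hz])⟩
    rw [aeval_algebraMap_apply]
    simpa using hA x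
  · exact .inl (aeval_Qpoly_ne_zero hm hz)

/-- If `Q` is a unit modulo `A`, then `A` divides the homogenization at `(P, Q)` of some monic
polynomial of degree `A.natDegree`. -/
theorem exists_monic_dvd_homogenization {K : Type*} [Field K] {A P Q : K[X]} (hA : A ≠ 0)
    (hQ : IsCoprime Q A) :
    ∃ E : K[X], E.Monic ∧ E.natDegree = A.natDegree ∧
      A ∣ ∑ l ∈ Finset.range (A.natDegree + 1),
        C (E.coeff (A.natDegree - l)) * P ^ (A.natDegree - l) * Q ^ l := by
  obtain ⟨c, d, hcd⟩ := hQ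
  have hc : AdjoinRoot.mk A c * AdjoinRoot.mk A Q = 1 := by
    rw [← map_mul, ← map_one (AdjoinRoot.mk A), ← hcd]
    simp
  have := (AdjoinRoot.powerBasis hA).finite
  set w := AdjoinRoot.mk A (P * c) with hw
  have hPw : AdjoinRoot.mk A P = w * AdjoinRoot.mk A Q := by
    rw [hw, map_mul, mul_assoc, hc, mul_one]
  set E := (Algebra.lmul K (AdjoinRoot A) w).charpoly with hE
  have hEdeg : E.natDegree = A.natDegree := by
    rw [hE, LinearMap.charpoly_natDegree, (AdjoinRoot.powerBasis hA).finrank,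
      AdjoinRoot.powerBasis_dim]
  have hEw : aeval w E = 0 := by
    have h := LinearMap.aeval_self_charpoly (Algebra.lmul K (AdjoinRoot A) w)
    rw [← hE, aeval_algHom_apply] at h
    simpa using congrArg (fun f => f 1) h
  refine ⟨E, LinearMap.charpoly_monic _, hEdeg, AdjoinRoot.mk_eq_zero.1 ?_⟩
  calc _ = ∑ l ∈ Finset.range (A.natDegree + 1), AdjoinRoot.mk A Q ^ A.natDegree *
          (AdjoinRoot.mk A (C (E.coeff (A.natDegree - l))) * w ^ (A.natDegree - l)) := by
        rw [map_sum]
        refine Finset.sum_congr rfl fun l hl => ?_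
        obtain ⟨k, hk⟩ := Nat.exists_eq_add_of_le (Finset.mem_range_succ_iff.1 hl)
        rw [map_mul, map_mul, map_pow, map_pow, hPw, show A.natDegree - l = k by omega, hk]
        ring
    _ = AdjoinRoot.mk A Q ^ A.natDegree * aeval w E := by
        rw [← Finset.mul_sum, aeval_eq_sum_range, hEdeg,
          ← Finset.sum_range_reflect (fun i => E.coeff i • w ^ i)]
        congr 1
        refine Finset.sum_congr rfl fun l _ => ?_
        rw [show A.natDegree + 1 - 1 - l = A.natDegree - l by omega, Algebra.smul_def]
        rfl
    _ = 0 := by rw [hEw, mul_zero]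

/-- Scaling theorem: for `A ∈ ℝ[x]` of degree `p` with no real zeros, there is a real
polynomial `Z` of degree `r = p(m−1)` and reals `e_0, …, e_p` with
`A·Z = Σ_{l=0}^{p} e_l P_m^{p−l} Q_m^{l}`. -/
theorem stmt1 (p m : ℕ) (hp : 0 < p) (hm : 0 < m) (A : Polynomial ℝ)
    (hdeg : A.natDegree = p) (hnr : ∀ x : ℝ, A.eval x ≠ 0) :
    ∃ (Z : Polynomial ℝ) (e : ℕ → ℝ),
      Z.natDegree = p * (m - 1) ∧
        A * Z = ∑ l ∈ Finset.range (p + 1),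
          Polynomial.C (e l) * (Ppoly m) ^ (p - l) * (Qpoly m) ^ l := by
  have hA : A ≠ 0 := fun h => hnr 0 (by simp [h])
  obtain ⟨E, hE, hEdeg, Z, hZ⟩ :=
    exists_monic_dvd_homogenization (P := Ppoly m) hA (isCoprime_Qpoly hm hnr)
  rw [hdeg] at hEdeg hZ
  refine ⟨Z, fun l => E.coeff (p - l), ?_, hZ.symm⟩
  obtain ⟨hP, hPdeg⟩ := monic_Ppoly m
  have hlt : (∑ l ∈ Finset.range p, C (E.coeff (p - (l + 1))) * Ppoly m ^ (p - (l + 1)) *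
      Qpoly m ^ (l + 1)).natDegree < p * m := by
    refine (natDegree_sum_le_of_forall_le (n := p * m - 1) _ _ fun l hl => ?_).trans_lt
      (Nat.sub_lt (Nat.mul_pos hp hm) one_pos)
    obtain ⟨k, rfl⟩ := Nat.exists_eq_add_of_lt (Finset.mem_range.1 hl)
    obtain ⟨n, rfl⟩ := Nat.exists_eq_add_of_lt hm
    rw [show l + k + 1 - (l + 1) = k by omega]
    have h1 : (Ppoly (0 + n + 1) ^ k).natDegree ≤ k * (n + 1) :=
      natDegree_pow_le_of_le k (by omega)
    have h2 : (Qpoly (0 + n + 1) ^ (l + 1)).natDegree ≤ (l + 1) * n :=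
      natDegree_pow_le_of_le (l + 1) (by simpa using natDegree_Qpoly_le (0 + n + 1))
    refine (natDegree_mul_le_of_le ((natDegree_C_mul_le _ _).trans h1) h2).trans
      (Nat.le_sub_one_of_lt ?_)
    nlinarith
  have hPp : (Ppoly m ^ p).natDegree = p * m := by rw [hP.natDegree_pow, hPdeg]
  have hS := congrArg natDegree hZ
  have hlead : E.coeff p = 1 := hEdeg ▸ hE.coeff_natDegree
  rw [Finset.sum_range_succ'] at hS
  simp only [Nat.sub_zero, pow_zero, mul_one, hlead, C_1, one_mul] at hS
  have hZ0 : Z ≠ 0 := by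
    rintro rfl
    rw [natDegree_add_eq_right_of_natDegree_lt (hPp ▸ hlt), hPp] at hS
    simp [hp.ne', hm.ne'] at hS
  rw [natDegree_add_eq_right_of_natDegree_lt (hPp ▸ hlt), hPp, natDegree_mul hA hZ0, hdeg] at hS
  rw [Nat.mul_sub, mul_one]
  omega
end

section
/- Let m be a positive integer and θ a real number with sin θ ≠ 0. Then P_m(cot θ) · sin^m θ = cos(mθ) and Q_m(cot θ) · sin^m θ = sin(mθ). -/
/-- `P_m(x) = Σ_{j=0}^{⌊m/2⌋} (−1)^j C(m,2j) x^{m−2j}`. -/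
noncomputable def Pm (m : ℕ) (x : ℝ) : ℝ :=
  ∑ j ∈ Finset.range (m / 2 + 1), (-1 : ℝ) ^ j * (m.choose (2 * j)) * x ^ (m - 2 * j)

/-- `Q_m(x) = Σ_{j=0}^{⌊(m−1)/2⌋} (−1)^j C(m,2j+1) x^{m−2j−1}`. -/
noncomputable def Qm (m : ℕ) (x : ℝ) : ℝ :=
  ∑ j ∈ Finset.range ((m - 1) / 2 + 1), (-1 : ℝ) ^ j * (m.choose (2 * j + 1)) * x ^ (m - (2 * j + 1))

theorem sum_range_two_mul {M : Type*} [AddCommMonoid M] (f : ℕ → M) (n : ℕ) :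
    ∑ k ∈ Finset.range (2 * n), f k = ∑ j ∈ Finset.range n, (f (2 * j) + f (2 * j + 1)) := by
  induction n with
  | zero => simp
  | succ n ih =>
    rw [mul_add, mul_one, Finset.sum_range_succ, Finset.sum_range_succ, Finset.sum_range_succ, ih,
      add_assoc]

theorem Qm_eq_sum_range_half (m : ℕ) (x : ℝ) :
    Qm m x = ∑ j ∈ Finset.range (m / 2 + 1),
      (-1 : ℝ) ^ j * (m.choose (2 * j + 1)) * x ^ (m - (2 * j + 1)) := by
  refine Finset.sum_subset (Finset.range_mono (by omega)) fun j _ hj => ?_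
  rw [Finset.mem_range] at hj
  rw [Nat.choose_eq_zero_of_lt (by omega)]
  simp

/-- `P_m(x)` and `Q_m(x)` are the real and imaginary parts of `(x + i)^m`. -/
theorem ofReal_add_I_pow (m : ℕ) (x : ℝ) :
    ((x : ℂ) + Complex.I) ^ m = (Pm m x : ℂ) + (Qm m x : ℂ) * Complex.I := by
  have hsub : ∑ k ∈ Finset.range (m + 1), Complex.I ^ k * (x : ℂ) ^ (m - k) * (m.choose k : ℂ) =
      ∑ k ∈ Finset.range (2 * (m / 2 + 1)),
        Complex.I ^ k * (x : ℂ) ^ (m - k) * (m.choose k : ℂ) := by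
    refine Finset.sum_subset (Finset.range_mono (by omega)) fun k _ hk => ?_
    rw [Finset.mem_range] at hk
    rw [Nat.choose_eq_zero_of_lt (by omega)]
    simp
  rw [add_comm, add_pow, hsub, sum_range_two_mul, Qm_eq_sum_range_half, Pm]
  push_cast
  rw [Finset.sum_mul, ← Finset.sum_add_distrib]
  refine Finset.sum_congr rfl fun j _ => ?_
  rw [pow_succ, pow_mul, Complex.I_sq]
  ring

/-- For `sin θ ≠ 0`: `P_m(cot θ) sin^m θ = cos(mθ)` and `Q_m(cot θ) sin^m θ = sin(mθ)`. -/
theorem stmt7 (m : ℕ) (hm : 0 < m) (θ : ℝ) (h : Real.sin θ ≠ 0) :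
    Pm m (Real.cot θ) * Real.sin θ ^ m = Real.cos (m * θ) ∧
      Qm m (Real.cot θ) * Real.sin θ ^ m = Real.sin (m * θ) := by
  have hcot : Real.cot θ * Real.sin θ = Real.cos θ := by
    rw [Real.cot_eq_cos_div_sin, div_mul_cancel₀ _ h]
  have key : ((Pm m (Real.cot θ) * Real.sin θ ^ m : ℝ) : ℂ) +
      ((Qm m (Real.cot θ) * Real.sin θ ^ m : ℝ) : ℂ) * Complex.I =
      (Real.cos (m * θ) : ℂ) + (Real.sin (m * θ) : ℂ) * Complex.I := by
    calc _ = (((Real.cot θ : ℝ) : ℂ) + Complex.I) ^ m * ((Real.sin θ : ℝ) : ℂ) ^ m := by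
          rw [ofReal_add_I_pow, Complex.ofReal_mul, Complex.ofReal_mul, Complex.ofReal_pow]
          ring
      _ = (Complex.cos θ + Complex.sin θ * Complex.I) ^ m := by
          rw [← mul_pow, add_mul, ← Complex.ofReal_mul, hcot, Complex.ofReal_cos,
            Complex.ofReal_sin, mul_comm Complex.I]
      _ = _ := by
          rw [Complex.cos_add_sin_mul_I_pow]
          push_cast
          rfl
  exact ⟨by simpa only [Complex.add_re, Complex.re_ofReal_mul, Complex.ofReal_re,
      Complex.I_re, mul_zero, add_zero] using congrArg Complex.re key,
    by simpa only [Complex.add_im, Complex.im_ofReal_mul, Complex.ofReal_im,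
      Complex.I_im, mul_one, zero_add] using congrArg Complex.im key⟩
end

section
/- Let a and b be even nonnegative integers, set c = (a+b)/2 and d = a/2, and let u be a real number. Then sin^a u · cos^b u = ((−1)^d / 2^{a+b}) · [ T_c(a,b) + Σ_{j=1}^{c} ( T_{c+j}(a,b) + T_{c−j}(a,b) ) · cos(2ju) ]. -/
/-- `T_x(a,b) = Σ_{j=0}^{x} (−1)^{a−x+j} C(a, x−j) C(b, j)`, where the sign exponent
`a−x+j` is computed in `ℤ` and `C(n,k) = 0` for `k > n` (and for `x−j` this is the
truncated natural subtraction, matching the convention `C(n,k) = 0` for `k < 0`). -/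
noncomputable def T (x a b : ℕ) : ℝ :=
  ∑ j ∈ Finset.range (x + 1),
    (-1 : ℝ) ^ ((a : ℤ) - (x : ℤ) + (j : ℤ)) * (a.choose (x - j)) * (b.choose j)

open Polynomial in
/-- `T x a b` is the coefficient of `X ^ x` in `(X - 1) ^ a * (X + 1) ^ b`. -/
theorem T_eq_coeff (x a b : ℕ) :
    T x a b = ((X - C 1 : ℝ[X]) ^ a * (X + 1) ^ b).coeff x := by
  rw [mul_comm, coeff_mul, Finset.Nat.sum_antidiagonal_eq_sum_range_succ_mk, T]
  refine Finset.sum_congr rfl fun j hj => ?_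
  have hj : j ≤ x := Nat.lt_succ_iff.mp (Finset.mem_range.mp hj)
  rw [coeff_X_add_one_pow, sub_eq_add_neg X, ← C_neg, coeff_X_add_C_pow]
  rcases le_or_gt (x - j) a with h | h
  · have hexp : (a : ℤ) - x + j = ((a - (x - j) : ℕ) : ℤ) := by omega
    rw [hexp, zpow_natCast]
    ring
  · simp [Nat.choose_eq_zero_of_lt h]

open Polynomial in
/-- The generating function of `T`, evaluated at a complex number. -/
theorem sub_one_pow_mul_add_one_pow_eq_sum_T (a b : ℕ) (z : ℂ) :
    (z - 1) ^ a * (z + 1) ^ b = ∑ x ∈ Finset.range (a + b + 1), (T x a b : ℂ) * z ^ x := by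
  have hdeg : ((X - C 1 : ℝ[X]) ^ a * (X + 1) ^ b).natDegree < a + b + 1 := by
    have h : ((X - C 1 : ℝ[X]) ^ a * (X + 1) ^ b).natDegree ≤ a + b := by compute_degree
    omega
  have h := aeval_eq_sum_range' hdeg z
  simp only [← T_eq_coeff, Algebra.smul_def] at h
  simpa using h

/-- A sum over `0, …, 2c` folded about its middle index `c`. -/
theorem sum_range_fold {M : Type*} [AddCommMonoid M] (f : ℕ → M) (c : ℕ) :
    ∑ x ∈ Finset.range (c + c + 1), f x =
      f c + ∑ j ∈ Finset.Icc 1 c, (f (c + j) + f (c - j)) := by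
  have hIcc : Finset.Icc 1 c = Finset.Ico 1 (c + 1) := by ext; simp
  rw [add_assoc, Finset.sum_range_add, Finset.sum_range_succ', hIcc,
    Finset.sum_Ico_eq_sum_range, Finset.sum_add_distrib, ← Finset.sum_range_reflect f c]
  have h (i : ℕ) : c - 1 - i = c - (1 + i) := by omega
  simp only [h, add_zero, add_comm _ 1, Nat.add_sub_cancel_left]
  abel

/-- The unfolded cosine expansion of `sin u ^ (2d) * cos u ^ (2e)`: the real part of the
generating function of `T` at `exp (2iu)`, divided by its phase `exp (2(d + e)iu)`. -/
theorem sin_pow_mul_cos_pow_eq_sum_T (d e : ℕ) (u : ℝ) :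
    (-1 : ℝ) ^ d * 2 ^ (d + d + (e + e)) * (Real.sin u ^ (d + d) * Real.cos u ^ (e + e)) =
      ∑ x ∈ Finset.range (d + e + (d + e) + 1),
        T x (d + d) (e + e) * Real.cos (2 * ((x : ℝ) - (d + e : ℕ)) * u) := by
  set w : ℂ := Complex.exp (u * Complex.I) with hw
  have hw0 : w ≠ 0 := Complex.exp_ne_zero _
  have hinv : Complex.exp (-u * Complex.I) = w⁻¹ := by rw [hw, ← Complex.exp_neg, neg_mul]
  have hsin : w ^ 2 - 1 = w * (2 * Complex.I * Complex.sin u) := by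
    rw [Complex.sin, hinv, ← hw]
    field_simp
    linear_combination (w ^ 2 - 1) * Complex.I_sq
  have hcos : w ^ 2 + 1 = w * (2 * Complex.cos u) := by
    rw [Complex.cos, hinv, ← hw]
    field_simp
  have hgen := sub_one_pow_mul_add_one_pow_eq_sum_T (d + d) (e + e) (w ^ 2)
  rw [hsin, hcos] at hgen
  have hI : Complex.I ^ (d + d) = (-1) ^ d := by rw [← two_mul, pow_mul, Complex.I_sq]
  have hphase (x : ℕ) : (w ^ 2) ^ x = w ^ (d + d + (e + e)) *
      Complex.exp ((2 * ((x : ℝ) - (d + e : ℕ)) * u : ℝ) * Complex.I) := by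
    simp only [hw, ← Complex.exp_nat_mul, ← Complex.exp_add]
    congr 1
    push_cast
    ring
  have key : (((-1 : ℝ) ^ d * 2 ^ (d + d + (e + e)) *
      (Real.sin u ^ (d + d) * Real.cos u ^ (e + e)) : ℝ) : ℂ) =
      ∑ x ∈ Finset.range (d + e + (d + e) + 1), (T x (d + d) (e + e) : ℂ) *
        Complex.exp ((2 * ((x : ℝ) - (d + e : ℕ)) * u : ℝ) * Complex.I) := by
    refine mul_left_cancel₀ (pow_ne_zero (d + d + (e + e)) hw0) ?_
    rw [Finset.mul_sum, add_add_add_comm d e d e]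
    simp only [hphase, mul_left_comm _ (w ^ (d + d + (e + e)))] at hgen
    rw [← hgen]
    push_cast
    simp only [mul_pow, hI]
    ring
  have hre := congrArg Complex.re key
  simpa only [Complex.ofReal_re, Complex.re_sum, Complex.re_ofReal_mul,
    Complex.exp_ofReal_mul_I_re] using hre

/-- For `a, b` even, with `c = (a+b)/2` and `d = a/2`:
`sin^a u cos^b u = ((−1)^d/2^{a+b}) [T_c(a,b) + Σ_{j=1}^{c} (T_{c+j}(a,b)+T_{c−j}(a,b)) cos(2ju)]`. -/
theorem stmt8 (a b : ℕ) (ha : Even a) (hb : Even b) (u : ℝ) :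
    Real.sin u ^ a * Real.cos u ^ b =
      ((-1 : ℝ) ^ (a / 2) / 2 ^ (a + b)) *
        (T ((a + b) / 2) a b +
          ∑ j ∈ Finset.Icc 1 ((a + b) / 2),
            (T ((a + b) / 2 + j) a b + T ((a + b) / 2 - j) a b) *
              Real.cos (2 * (j : ℝ) * u)) := by
  obtain ⟨d, rfl⟩ := ha
  obtain ⟨e, rfl⟩ := hb
  have hc : (d + d + (e + e)) / 2 = d + e := by omega
  have hd : (d + d) / 2 = d := by omega
  have hfold := sin_pow_mul_cos_pow_eq_sum_T d e u
  rw [sum_range_fold, sub_self, mul_zero, zero_mul, Real.cos_zero, mul_one] at hfold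
  have hterm : ∀ j ∈ Finset.Icc 1 (d + e),
      T (d + e + j) (d + d) (e + e) *
          Real.cos (2 * (((d + e + j : ℕ) : ℝ) - (d + e : ℕ)) * u) +
        T (d + e - j) (d + d) (e + e) *
          Real.cos (2 * (((d + e - j : ℕ) : ℝ) - (d + e : ℕ)) * u) =
      (T (d + e + j) (d + d) (e + e) + T (d + e - j) (d + d) (e + e)) *
        Real.cos (2 * (j : ℝ) * u) := by
    intro j hj
    have hneg : 2 * (((d + e : ℕ) : ℝ) - j - (d + e : ℕ)) * u = -(2 * (j : ℝ) * u) := by ring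
    rw [Nat.cast_sub (Finset.mem_Icc.mp hj).2, hneg, Real.cos_neg, Nat.cast_add (d + e) j,
      add_sub_cancel_left, add_mul]
  rw [Finset.sum_congr rfl hterm] at hfold
  rw [hc, hd, ← hfold]
  have hsq : (-1 : ℝ) ^ d * (-1) ^ d = 1 := by rw [← mul_pow]; simp
  field_simp
  linear_combination -(Real.sin u ^ (d + d) * Real.cos u ^ (e + e)) * hsq
end

section
/- Let a be an even nonnegative integer and b an odd nonnegative integer, set c = (a+b+1)/2 and d = a/2, and let u be a real number. Then sin^a u · cos^b u = ((−1)^d / 2^{a+b}) · Σ_{j=1}^{c} ( T_{c−1+j}(a,b) + T_{c−j}(a,b) ) · cos((2j−1)u). -/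
open Polynomial in
/-- The numbers `T x a b` are the coefficients of `(X + 1) ^ b * (X - 1) ^ a`. -/
theorem coeff_X_add_one_pow_mul_X_sub_one_pow (x a b : ℕ) :
    ((X + C (1 : ℝ)) ^ b * (X + C (-1 : ℝ)) ^ a).coeff x = T x a b := by
  rw [coeff_mul, Finset.Nat.sum_antidiagonal_eq_sum_range_succ_mk, T]
  refine Finset.sum_congr rfl fun j hj => ?_
  have hjx : j ≤ x := Nat.lt_succ_iff.mp (Finset.mem_range.mp hj)
  simp only [coeff_X_add_C_pow, one_pow, one_mul]
  rcases le_or_gt (x - j) a with h | h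
  · rw [show (a : ℤ) - x + j = ((a - (x - j) : ℕ) : ℤ) by omega, zpow_natCast]
    ring
  · simp [Nat.choose_eq_zero_of_lt h]

open Polynomial in
theorem sum_T_mul_pow (a b : ℕ) (z : ℂ) :
    ∑ x ∈ Finset.range (a + b + 1), (T x a b : ℂ) * z ^ x = (z + 1) ^ b * (z - 1) ^ a := by
  have hdeg : ((X + C (1 : ℝ)) ^ b * (X + C (-1 : ℝ)) ^ a).natDegree < a + b + 1 := by
    refine Nat.lt_succ_iff.mpr (natDegree_mul_le.trans ?_)
    rw [natDegree_pow_X_add_C, natDegree_pow_X_add_C, add_comm]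
  have h := aeval_eq_sum_range' hdeg z
  simp only [coeff_X_add_one_pow_mul_X_sub_one_pow, Complex.real_smul] at h
  rw [← h]
  simp [sub_eq_add_neg]

/-- The Fourier expansion of `sin u ^ a * cos u ^ b` for even `a`. -/
theorem sum_T_mul_cos (a b : ℕ) (ha : Even a) (u : ℝ) :
    ∑ x ∈ Finset.range (a + b + 1), T x a b * Real.cos ((2 * (x : ℝ) - (a + b)) * u) =
      (-1) ^ (a / 2) * 2 ^ (a + b) * (Real.sin u ^ a * Real.cos u ^ b) := by
  set w : ℂ := Complex.exp (u * Complex.I) with hw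
  set v : ℂ := Complex.exp (-u * Complex.I) with hv
  have hwv : w * v = 1 := by rw [hw, hv, ← Complex.exp_add]; simp
  have hcos : w + v = 2 * Complex.cos u := by rw [Complex.cos]; ring
  have hsin : w - v = 2 * Complex.I * Complex.sin u := by
    rw [Complex.sin]
    linear_combination (w - v) * Complex.I_sq
  have hI : Complex.I ^ a = (-1) ^ (a / 2) := by
    rw [← Complex.I_sq, ← pow_mul, Nat.mul_div_cancel' ha.two_dvd]
  have key : ∑ x ∈ Finset.range (a + b + 1),
      (T x a b : ℂ) * Complex.exp (((2 * (x : ℝ) - (a + b)) * u : ℝ) * Complex.I) =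
      (((-1) ^ (a / 2) * 2 ^ (a + b) * (Real.sin u ^ a * Real.cos u ^ b) : ℝ) : ℂ) := by
    calc _ = v ^ (a + b) * ∑ x ∈ Finset.range (a + b + 1), (T x a b : ℂ) * (w ^ 2) ^ x := by
          rw [Finset.mul_sum]
          refine Finset.sum_congr rfl fun x _ => ?_
          rw [mul_left_comm, hw, hv]
          simp only [← Complex.exp_nat_mul, ← Complex.exp_add]
          congr 2
          push_cast
          ring
      _ = (v * (w ^ 2 + 1)) ^ b * (v * (w ^ 2 - 1)) ^ a := by
          rw [sum_T_mul_pow, mul_pow, mul_pow]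
          ring
      _ = (w + v) ^ b * (w - v) ^ a := by
          congr 2
          · linear_combination w * hwv
          · linear_combination w * hwv
      _ = _ := by
          rw [hcos, hsin]
          simp only [mul_pow, hI]
          push_cast
          ring
  have hre := congrArg Complex.re key
  rw [Complex.ofReal_re, Complex.re_sum] at hre
  simpa only [Complex.re_ofReal_mul, Complex.exp_ofReal_mul_I_re] using hre

/-- For `a` even and `b` odd, with `c = (a+b+1)/2` and `d = a/2`:
`sin^a u cos^b u = ((−1)^d/2^{a+b}) Σ_{j=1}^{c} (T_{c−1+j}(a,b)+T_{c−j}(a,b)) cos((2j−1)u)`. -/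
theorem stmt9 (a b : ℕ) (ha : Even a) (hb : Odd b) (u : ℝ) :
    Real.sin u ^ a * Real.cos u ^ b =
      ((-1 : ℝ) ^ (a / 2) / 2 ^ (a + b)) *
        ∑ j ∈ Finset.Icc 1 ((a + b + 1) / 2),
          (T ((a + b + 1) / 2 - 1 + j) a b + T ((a + b + 1) / 2 - j) a b) *
            Real.cos ((2 * (j : ℝ) - 1) * u) := by
  obtain ⟨c, hc⟩ : ∃ c, a + b + 1 = c + c := (ha.add_odd hb).add_one
  have hcR : (a : ℝ) + b = 2 * c - 1 := by
    have : (a : ℝ) + b + 1 = c + c := mod_cast hc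
    linarith
  have hsum : ∑ j ∈ Finset.Icc 1 c, (T (c - 1 + j) a b + T (c - j) a b) *
      Real.cos ((2 * (j : ℝ) - 1) * u) =
      (-1) ^ (a / 2) * 2 ^ (a + b) * (Real.sin u ^ a * Real.cos u ^ b) := by
    rw [← sum_T_mul_cos a b ha u, hc, Finset.sum_range_add, ← Finset.sum_range_reflect _ c,
      ← Finset.sum_add_distrib, ← Finset.Ico_add_one_right_eq_Icc, Finset.sum_Ico_eq_sum_range,
      Nat.add_sub_cancel]
    refine Finset.sum_congr rfl fun k hk => ?_
    have hkc : k + 1 ≤ c := Finset.mem_range.mp hk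
    rw [show c - 1 + (1 + k) = c + k by omega, show c - 1 - k = c - (1 + k) by omega, hcR,
      ← Real.cos_neg ((2 * ((c - (1 + k) : ℕ) : ℝ) - (2 * c - 1)) * u),
      Nat.cast_sub (by omega)]
    push_cast
    ring_nf
  rw [show (a + b + 1) / 2 = c by omega, hsum]
  have hsq : ((-1 : ℝ) ^ (a / 2)) * (-1) ^ (a / 2) = 1 := by rw [← mul_pow]; simp
  field_simp
  linear_combination (-(Real.sin u ^ a * Real.cos u ^ b)) * hsq
end

section
/- Let p = 2ν be an even positive integer, α an integer with 0 ≤ α ≤ ν − 1, and e_0, …, e_p real numbers such that ET_{1,p}(θ) := Σ_{l=0}^{p} e_l cos^{p−l}θ sin^{l}θ is nonzero for all real θ. Set H(y) = Σ_{l=0}^{p} e_l y^{p−l}. Then ∫_0^{π} cos(2αθ)/ET_{1,p}(θ) dθ = ∫_{−∞}^{∞} (1 + y²)^{ν−α−1} P_{2α}(y) / H(y) dy; in particular, for α = 0, ∫_0^{π} dθ/ET_{1,p}(θ) = ∫_{−∞}^{∞} (1 + y²)^{ν−1} dy / H(y). -/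
open Real

/-- `ET_{1,p}(θ) = Σ_{l=0}^{p} e_l cos^{p−l}θ sin^{l}θ`. -/
noncomputable def ET1 (p : ℕ) (e : ℕ → ℝ) (θ : ℝ) : ℝ :=
  ∑ l ∈ Finset.range (p + 1), e l * Real.cos θ ^ (p - l) * Real.sin θ ^ l

/-- `H(y) = Σ_{l=0}^{p} e_l y^{p−l}`. -/
noncomputable def Hfun (p : ℕ) (e : ℕ → ℝ) (y : ℝ) : ℝ :=
  ∑ l ∈ Finset.range (p + 1), e l * y ^ (p - l)

theorem sum_range_two_mul_succ {M : Type*} [AddCommMonoid M] (f : ℕ → M) (n : ℕ) :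
    ∑ k ∈ Finset.range (2 * n + 1), f k =
      ∑ j ∈ Finset.range (n + 1), f (2 * j) + ∑ j ∈ Finset.range n, f (2 * j + 1) := by
  induction n with
  | zero => simp
  | succ n ih =>
    rw [show 2 * (n + 1) + 1 = 2 * n + 1 + 1 + 1 by ring, Finset.sum_range_succ,
      Finset.sum_range_succ, ih, Finset.sum_range_succ _ (n + 1),
      Finset.sum_range_succ (fun j => f (2 * j + 1)) n,
      show 2 * n + 1 + 1 = 2 * (n + 1) by ring]
    abel

/-- `P_m(y)` is the real part of `(y + i)^m`, for `m` even. -/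
theorem Pm_two_mul_eq_re (n : ℕ) (y : ℝ) :
    Pm (2 * n) y = (((y : ℂ) + Complex.I) ^ (2 * n)).re := by
  rw [add_comm, add_pow, sum_range_two_mul_succ, Complex.add_re, Complex.re_sum, Complex.re_sum, Pm]
  have hodd : ∀ j ∈ Finset.range n, (Complex.I ^ (2 * j + 1) * (y : ℂ) ^ (2 * n - (2 * j + 1)) *
      ((2 * n).choose (2 * j + 1) : ℂ)).re = 0 := by
    intro j _
    have h : Complex.I ^ (2 * j + 1) * (y : ℂ) ^ (2 * n - (2 * j + 1)) *
        ((2 * n).choose (2 * j + 1) : ℂ) =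
        (((-1) ^ j * y ^ (2 * n - (2 * j + 1)) * (2 * n).choose (2 * j + 1) : ℝ) : ℂ) *
          Complex.I := by
      rw [pow_succ, pow_mul, Complex.I_sq]
      push_cast
      ring
    rw [h, Complex.re_ofReal_mul, Complex.I_re, mul_zero]
  rw [Finset.sum_eq_zero hodd, add_zero, Nat.mul_div_cancel_left n two_pos]
  refine Finset.sum_congr rfl fun j _ => ?_
  have h : Complex.I ^ (2 * j) * (y : ℂ) ^ (2 * n - 2 * j) * ((2 * n).choose (2 * j) : ℂ) =
      (((-1) ^ j * (2 * n).choose (2 * j) * y ^ (2 * n - 2 * j) : ℝ) : ℂ) := by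
    rw [pow_mul, Complex.I_sq]
    push_cast
    ring
  rw [h, Complex.ofReal_re]

theorem cos_two_mul_eq_sin_pow_mul_Pm (n : ℕ) {θ y : ℝ} (h : cos θ = y * sin θ) :
    cos (2 * (n : ℝ) * θ) = sin θ ^ (2 * n) * Pm (2 * n) y := by
  have key : (((sin θ ^ (2 * n) : ℝ) : ℂ)) * ((y : ℂ) + Complex.I) ^ (2 * n) =
      Complex.cos ((2 * (n : ℝ) * θ : ℝ)) + Complex.sin ((2 * (n : ℝ) * θ : ℝ)) * Complex.I := by
    have hc : (Complex.cos θ : ℂ) = y * Complex.sin θ := by exact_mod_cast congrArg Complex.ofReal h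
    have := Complex.cos_add_sin_mul_I_pow (2 * n) (θ : ℂ)
    push_cast at this ⊢
    rw [← this, hc, ← mul_pow]
    ring
  have hre := congrArg Complex.re key
  rw [Complex.re_ofReal_mul, ← Pm_two_mul_eq_re] at hre
  rw [hre, ← Complex.ofReal_cos, ← Complex.ofReal_sin, Complex.add_re, Complex.ofReal_re,
    Complex.re_ofReal_mul, Complex.I_re, mul_zero, add_zero]

theorem ET1_eq_sin_pow_mul_Hfun (p : ℕ) (e : ℕ → ℝ) {θ y : ℝ} (h : cos θ = y * sin θ) :
    ET1 p e θ = sin θ ^ p * Hfun p e y := by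
  rw [ET1, Hfun, Finset.mul_sum]
  refine Finset.sum_congr rfl fun l hl => ?_
  have hl' : p = (p - l) + l := by have := Finset.mem_range.1 hl; omega
  rw [h, mul_pow]
  nth_rw 3 [hl']
  rw [pow_add]
  ring

/-- The substitution `θ = arccot y = π / 2 - arctan y`. -/
theorem integral_zero_pi_eq_integral_arccot (g : ℝ → ℝ) :
    ∫ θ in (0 : ℝ)..π, g θ = ∫ y : ℝ, (1 + y ^ 2)⁻¹ * g (π / 2 - arctan y) := by
  have himage : (fun y => π / 2 - arctan y) '' Set.univ = Set.Ioo 0 π := by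
    rw [Set.image_univ, show (fun y => π / 2 - arctan y) = (fun t => π / 2 - t) ∘ arctan from rfl,
      Set.range_comp, range_arctan, Set.image_const_sub_Ioo]
    congr 1 <;> ring
  rw [intervalIntegral.integral_of_le pi_pos.le, MeasureTheory.integral_Ioc_eq_integral_Ioo,
    ← himage, MeasureTheory.integral_image_eq_integral_abs_deriv_smul MeasurableSet.univ
      (fun y _ => ((hasDerivAt_arctan' y).const_sub (π / 2)).hasDerivWithinAt)
      (fun a _ b _ hab => arctan_injective (sub_right_injective hab)),
    MeasureTheory.setIntegral_univ]
  refine MeasureTheory.integral_congr_ae (Filter.Eventually.of_forall fun y => ?_)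
  have hy : (0 : ℝ) < (1 + y ^ 2)⁻¹ := by positivity
  simp only [abs_neg, abs_of_pos hy, smul_eq_mul]

/-- For `p = 2ν` even, `0 ≤ α ≤ ν−1`, and `ET_{1,p}` nowhere vanishing:
`∫_0^π cos(2αθ)/ET_{1,p}(θ) dθ = ∫_{−∞}^{∞} (1+y²)^{ν−α−1} P_{2α}(y)/H(y) dy`
(the case `α = 0` gives `∫_0^π dθ/ET_{1,p}(θ) = ∫_{−∞}^{∞} (1+y²)^{ν−1} dy/H(y)`). -/
theorem stmt19 (ν : ℕ) (hν : 0 < ν) (α : ℕ) (hα : α ≤ ν - 1) (e : ℕ → ℝ)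
    (hET : ∀ θ : ℝ, ET1 (2 * ν) e θ ≠ 0) :
    (∫ θ in (0:ℝ)..π, Real.cos (2 * (α : ℝ) * θ) / ET1 (2 * ν) e θ) =
      ∫ y : ℝ, (1 + y ^ 2) ^ (ν - α - 1) * Pm (2 * α) y / Hfun (2 * ν) e y := by
  rw [integral_zero_pi_eq_integral_arccot]
  refine MeasureTheory.integral_congr_ae (Filter.Eventually.of_forall fun y => ?_)
  have hsin : sin (π / 2 - arctan y) = cos (arctan y) := sin_pi_div_two_sub _
  have hcot : cos (π / 2 - arctan y) = y * sin (π / 2 - arctan y) := by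
    rw [hsin, cos_pi_div_two_sub, sin_arctan, cos_arctan]
    ring
  have hH := hET (π / 2 - arctan y)
  simp only [cos_two_mul_eq_sin_pow_mul_Pm α hcot]
  rw [ET1_eq_sin_pow_mul_Hfun _ e hcot] at hH ⊢
  have hH' := right_ne_zero_of_mul hH
  have hy : (1 + y ^ 2) ≠ 0 := by positivity
  obtain ⟨k, rfl⟩ : ∃ k, ν = α + k + 1 := ⟨ν - α - 1, by omega⟩
  rw [hsin, pow_mul, pow_mul, cos_sq_arctan, one_div, inv_pow, inv_pow,
    show α + k + 1 - α - 1 = k by omega]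
  field_simp
  ring
end
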